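/- For every integer n ≥ 1, the Stirling-derangement polynomials satisfy R_{n+1}(x,q) = 2nx·R_n(x,q) + 2x(1−x)·∂R_n(x,q)/∂x + 2nxq·R_{n−1}(x,q), with R_0(x,q) = 1 and R_1(x,q) = 0. -/

import Mathlib

open scoped Classical
noncomputable section

/-- The multiset `{1,1,2,2,…,n,n}` as a list. -/
def baseList (n : ℕ) : List ℕ := (List.range n).flatMap (fun i => [i + 1, i + 1])

/-- A word is Stirling if whenever the same value occurs at positions `i < k`,
every entry strictly between them is greater than that value. -/
def IsStirlingWord (l : List ℕ) : Prop :=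
  ∀ i j k : Fin l.length, i < j → j < k → l.get i = l.get k → l.get i < l.get j

/-- The set `Q_n` of Stirling permutations of order `n`:  rearrangements of the
multiset `{1,1,2,2,…,n,n}` in which all entries between the two occurrences of any
value exceed that value. -/
def stirlingPerms (n : ℕ) : Finset (List ℕ) :=
  ((baseList n).permutations.toFinset).filter IsStirlingWord

/-- Number of descents of `σ ∈ Q_n`: indices `i ∈ {1,…,2n}` (here 0-based) with
`σ_i > σ_{i+1}`, with the convention `σ_{2n+1} = 0`. -/
def desList (l : List ℕ) : ℕ :=
  ((Finset.range l.length).filter (fun i => l.getD (i + 1) 0 < l.getD i 0)).card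

/-- The second-order Eulerian polynomial `C_n(x) = ∑_{σ ∈ Q_n} x^{des σ}`. -/
def Cpoly (n : ℕ) : Polynomial ℚ :=
  ∑ σ ∈ stirlingPerms n, Polynomial.X ^ desList σ

/-- A list of cycles is a valid standard cycle form of a Stirling permutation of the
second kind of order `n` if:  the cycles are disjoint and together use each of
`1,1,2,2,…,n,n` exactly once; both copies of any value lie in the same cycle; each
cycle starts with (one of) its smallest entries; the cycles are listed in increasing
order of their smallest (first) entries; and the word of each cycle reduces to a
Stirling permutation. -/
def IsStirling2 (n : ℕ) (c : List (List ℕ)) : Prop :=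
  c.flatten.Perm (baseList n) ∧
  (∀ w ∈ c, w ≠ [] ∧ (∀ v ∈ w, w.count v = 2) ∧ (∀ v ∈ w, w.headI ≤ v) ∧
      IsStirlingWord w) ∧
  c.Chain' (fun w₁ w₂ => w₁.headI < w₂.headI)

/-- The set `Q_n²` of Stirling permutations of the second kind of order `n`,
each recorded as its standard cycle form (a list of cycles). -/
def stirling2 (n : ℕ) : Finset (List (List ℕ)) :=
  ((((baseList n).permutations.toFinset) ×ˢ (Finset.univ : Finset (Composition (2 * n)))).image
      (fun p => p.1.splitWrtComposition p.2)).filter (IsStirling2 n)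

/-- `cyc(σ)`: the number of cycles. -/
def cyc (c : List (List ℕ)) : ℕ := c.length

/-- `cplat(σ)`: the number of cycle plateaus, i.e. entries `c_i` of a cycle
`(c_1,…,c_{2k})` with `c_i = c_{i+1}`, `1 ≤ i < 2k`. -/
def cplat (c : List (List ℕ)) : ℕ :=
  (c.map (fun w => ((Finset.range w.length).filter
    (fun i => i + 1 < w.length ∧ w.getD i 0 = w.getD (i + 1) 0)).card)).sum

/-- `casc(σ)`: the number of cycle ascents, i.e. entries `c_i` of a cycle
`(c_1,…,c_{2k})` with `c_i < c_{i+1}`, `1 ≤ i < 2k`. -/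
def casc (c : List (List ℕ)) : ℕ :=
  (c.map (fun w => ((Finset.range w.length).filter
    (fun i => i + 1 < w.length ∧ w.getD i 0 < w.getD (i + 1) 0)).card)).sum

/-- `cap(σ)`: the number of cycle ascent plateaus, i.e. entries `c_i` of a cycle
`(c_1,…,c_{2k})` with `c_{i-1} < c_i = c_{i+1}`, `2 ≤ i ≤ 2k-1`. -/
def capSt (c : List (List ℕ)) : ℕ :=
  (c.map (fun w => ((Finset.range w.length).filter
    (fun i => 0 < i ∧ i + 1 < w.length ∧
      w.getD (i - 1) 0 < w.getD i 0 ∧ w.getD i 0 = w.getD (i + 1) 0)).card)).sum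

/-- `fix(σ)`: the number of fixed points, i.e. values `k` with `(k,k)` a cycle of `σ`. -/
def fixSt (c : List (List ℕ)) : ℕ :=
  ((Finset.range c.length).filter (fun i => ∃ k : ℕ, c.getD i [] = [k, k])).card

open MvPolynomial in
/-- `R_{n,k}(x,q) = ∑_{σ ∈ Q_n², fix(σ) = k} x^{cap(σ)} q^{cyc(σ)}`, in the variables
`x = X 0`, `q = X 1`. -/
def Rnk (n k : ℕ) : MvPolynomial (Fin 2) ℚ :=
  ∑ σ ∈ (stirling2 n).filter (fun σ => fixSt σ = k), X 0 ^ capSt σ * X 1 ^ cyc σ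

/-- The Stirling derangement polynomial `R_n(x,q) = R_{n,0}(x,q)`:  the sum of
`x^{cap(σ)} q^{cyc(σ)}` over Stirling derangements (fixed-point-free `σ ∈ Q_n²`). -/
def Rq (n : ℕ) : MvPolynomial (Fin 2) ℚ := Rnk n 0


/-- The number of ascent plateaus of a word. -/
def wordCap (w : List ℕ) : ℕ :=
  ((Finset.range w.length).filter (fun i => 0 < i ∧ i + 1 < w.length ∧
      w.getD (i - 1) 0 < w.getD i 0 ∧ w.getD i 0 = w.getD (i + 1) 0)).card

theorem wordCap_nil : wordCap [] = 0 := by simp [wordCap]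

theorem wordCap_singleton (a : ℕ) : wordCap [a] = 0 := by simp [wordCap]

theorem wordCap_pair (a b : ℕ) : wordCap [a, b] = 0 := by
  simp [wordCap]; omega

theorem wordCap_cons (a b c : ℕ) (t : List ℕ) :
    wordCap (a :: b :: c :: t) = (if a < b ∧ b = c then 1 else 0) + wordCap (b :: c :: t) := by
  simp only [wordCap, Finset.card_filter, List.length_cons]
  rw [Finset.sum_range_succ', Finset.sum_range_succ', Finset.sum_range_succ' _ (t.length + 1)]
  simp
  rw [add_comm]

theorem capSt_nil : capSt [] = 0 := rfl

theorem capSt_cons (w : List ℕ) (c : List (List ℕ)) : capSt (w :: c) = wordCap w + capSt c := rfl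

theorem fixSt_nil : fixSt [] = 0 := by simp [fixSt]

theorem fixSt_cons (w : List ℕ) (c : List (List ℕ)) :
    fixSt (w :: c) = (if ∃ k, w = [k, k] then 1 else 0) + fixSt c := by
  simp only [fixSt, Finset.card_filter, List.length_cons]
  rw [Finset.sum_range_succ']
  simp [add_comm]

theorem fixSt_eq_zero_iff {c : List (List ℕ)} : fixSt c = 0 ↔ ∀ k, [k, k] ∉ c := by
  induction c with
  | nil => simp [fixSt_nil]
  | cons w c ih =>
    rw [fixSt_cons]
    simp only [Nat.add_eq_zero_iff, ih]
    simp [List.mem_cons, not_or, forall_and, eq_comm]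

theorem fixSt_perm {c d : List (List ℕ)} (h : c.Perm d) : fixSt c = fixSt d := by
  induction h with
  | nil => rfl
  | cons _ _ ih => simp [fixSt_cons, ih]
  | swap => simp [fixSt_cons]; omega
  | trans _ _ h₁ h₂ => exact h₁.trans h₂

theorem capSt_perm {c d : List (List ℕ)} (h : c.Perm d) : capSt c = capSt d :=
  (h.map _).sum_eq

theorem isStirlingWord_iff {w : List ℕ} :
    IsStirlingWord w ↔ ∀ a b, List.Sublist [a, b, a] w → a < b := by
  constructor
  · intro h a b hs
    obtain ⟨f, hf⟩ := List.sublist_iff_exists_fin_orderEmbedding_get_eq.1 hs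
    have h0 := hf ⟨0, by simp⟩
    have h1 := hf ⟨1, by simp⟩
    have h2 := hf ⟨2, by simp⟩
    have := h (f ⟨0, by simp⟩) (f ⟨1, by simp⟩) (f ⟨2, by simp⟩) (by simp) (by simp)
      (by rw [← h0, ← h2]; rfl)
    rw [← h0, ← h1] at this
    exact this
  · intro h i j k hij hjk hik
    apply h
    rw [List.sublist_iff_exists_fin_orderEmbedding_get_eq]
    refine ⟨OrderEmbedding.ofStrictMono ![i, j, k] ?_, ?_⟩
    · intro x y hxy
      fin_cases x <;> fin_cases y <;> simp_all
      exact hij.trans hjk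
    · intro x
      fin_cases x
      exacts [rfl, rfl, hik]

/-- A word that may occur as a cycle of a Stirling permutation of the second kind. -/
def IsCycleWord (w : List ℕ) : Prop :=
  w ≠ [] ∧ (∀ v ∈ w, w.count v = 2) ∧ (∀ v ∈ w, w.headI ≤ v) ∧ IsStirlingWord w

/-- The words obtained from `w` by inserting `m, m` right after one of its letters. -/
def insertWord (m : ℕ) : List ℕ → List (List ℕ)
  | [] => []
  | a :: w => (a :: m :: m :: w) :: (insertWord m w).map (a :: ·)

/-- The lists of cycles obtained from `c` by inserting `m, m` right after one of its letters. -/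
def insertCycles (m : ℕ) : List (List ℕ) → List (List (List ℕ))
  | [] => []
  | w :: c => (insertWord m w).map (· :: c) ++ (insertCycles m c).map (w :: ·)

theorem mem_insertWord {m : ℕ} {w w' : List ℕ} :
    w' ∈ insertWord m w ↔ ∃ u v, u ≠ [] ∧ w = u ++ v ∧ w' = u ++ m :: m :: v := by
  induction w generalizing w' with
  | nil => simp [insertWord]
  | cons a w ih =>
    simp only [insertWord, List.mem_cons, List.mem_map, ih]
    constructor
    · rintro (rfl | ⟨_, ⟨u, v, hu, rfl, rfl⟩, rfl⟩)
      · exact ⟨[a], w, by simp⟩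
      · exact ⟨a :: u, v, by simp⟩
    · rintro ⟨_ | ⟨b, u⟩, v, hu, hw, rfl⟩
      · exact absurd rfl hu
      · obtain ⟨rfl, rfl⟩ : a = b ∧ w = u ++ v := by simpa using hw
        rcases eq_or_ne u [] with rfl | hu'
        · simp
        · exact .inr ⟨_, ⟨u, v, hu', rfl, rfl⟩, rfl⟩

theorem mem_insertCycles {m : ℕ} {c c' : List (List ℕ)} :
    c' ∈ insertCycles m c ↔ ∃ c₁ u v c₂, u ≠ [] ∧ c = c₁ ++ (u ++ v) :: c₂ ∧
      c' = c₁ ++ (u ++ m :: m :: v) :: c₂ := by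
  induction c generalizing c' with
  | nil => simp [insertCycles]
  | cons w c ih =>
    simp only [insertCycles, List.mem_append, List.mem_map, ih, mem_insertWord]
    constructor
    · rintro (⟨_, ⟨u, v, hu, rfl, rfl⟩, rfl⟩ | ⟨_, ⟨c₁, u, v, c₂, hu, rfl, rfl⟩, rfl⟩)
      · exact ⟨[], u, v, c, hu, rfl, rfl⟩
      · exact ⟨w :: c₁, u, v, c₂, hu, rfl, rfl⟩
    · rintro ⟨_ | ⟨b, c₁⟩, u, v, c₂, hu, hw, rfl⟩
      · obtain ⟨rfl, rfl⟩ : w = u ++ v ∧ c = c₂ := by simpa using hw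
        exact .inl ⟨_, ⟨u, v, hu, rfl, rfl⟩, rfl⟩
      · obtain ⟨rfl, rfl⟩ : w = b ∧ c = c₁ ++ (u ++ v) :: c₂ := by simpa using hw
        exact .inr ⟨_, ⟨c₁, u, v, c₂, hu, rfl, rfl⟩, rfl⟩

theorem length_of_mem_insertWord {m : ℕ} {w w' : List ℕ} (h : w' ∈ insertWord m w) :
    w'.length = w.length + 2 := by
  obtain ⟨u, v, -, rfl, rfl⟩ := mem_insertWord.1 h
  simp; omega

theorem length_of_mem_insertCycles {m : ℕ} {c c' : List (List ℕ)} (h : c' ∈ insertCycles m c) :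
    c'.length = c.length := by
  obtain ⟨c₁, u, v, c₂, -, rfl, rfl⟩ := mem_insertCycles.1 h
  simp

theorem not_fix_of_mem_insertWord {m : ℕ} {w w' : List ℕ} (h : w' ∈ insertWord m w) :
    ¬ ∃ k, w' = [k, k] := by
  rintro ⟨k, rfl⟩
  obtain ⟨u, v, hu, rfl, hw⟩ := mem_insertWord.1 h
  have := congrArg List.length hw
  have := List.length_pos_iff.2 hu
  simp at *
  omega

theorem nodup_insertWord {m : ℕ} {w : List ℕ} (h : m ∉ w) : (insertWord m w).Nodup := by
  induction w with
  | nil => simp [insertWord]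
  | cons a w ih =>
    simp only [List.mem_cons, not_or] at h
    refine List.nodup_cons.2 ⟨?_, (ih h.2).map (List.cons_injective)⟩
    simp only [List.mem_map, List.cons.injEq, true_and, exists_eq_right, mem_insertWord]
    rintro ⟨_ | ⟨b, u⟩, v, hu, rfl, hw⟩
    · exact hu rfl
    · simp at hw h
      grind

theorem nodup_insertCycles {m : ℕ} {c : List (List ℕ)} (h : ∀ w ∈ c, m ∉ w) :
    (insertCycles m c).Nodup := by
  induction c with
  | nil => simp [insertCycles]
  | cons w c ih =>
    simp only [List.mem_cons, forall_eq_or_imp] at h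
    refine List.Nodup.append ((nodup_insertWord h.1).map fun _ _ e => (List.cons.inj e).1)
      ((ih h.2).map List.cons_injective) ?_
    intro d hd hd'
    obtain ⟨w', hw', rfl⟩ := List.mem_map.1 hd
    obtain ⟨d', -, hd''⟩ := List.mem_map.1 hd'
    have := length_of_mem_insertWord hw'
    rw [(List.cons.inj hd'').1] at this
    omega

section GeneratingFunctions

variable {A : Type*} [CommRing A] (x : A)

theorem wordCap_insert_head {a m : ℕ} {w : List ℕ} (h : ∀ v ∈ a :: w, v < m) :
    wordCap (a :: m :: m :: w) = 1 + wordCap w := by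
  rcases w with _ | ⟨b, _ | ⟨c, t⟩⟩ <;>
    simp_all [wordCap_cons, wordCap_pair, wordCap_nil, wordCap_singleton]
  all_goals omega

theorem sum_insertWord {m : ℕ} {w : List ℕ} (h : ∀ v ∈ w, v < m) :
    ((insertWord m w).map fun w' => x ^ wordCap w').sum =
      2 * wordCap w * x ^ wordCap w + (w.length - 2 * wordCap w) * x ^ (wordCap w + 1) := by
  induction w with
  | nil => simp [insertWord, wordCap_nil]
  | cons a w ih =>
    have hm := wordCap_insert_head h
    have ih := ih fun v hv => h v (List.mem_cons_of_mem _ hv)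
    rcases w with _ | ⟨b, _ | ⟨c, t⟩⟩
    · simp [insertWord, wordCap_singleton, hm, wordCap_nil]
    · simp [insertWord, wordCap_singleton, hm, wordCap_pair, wordCap_cons] at h ⊢
      have : ¬ m < b := by omega
      simp [*, h.2.ne]
      ring
    · have hb : wordCap (b :: m :: m :: c :: t) = 1 + wordCap (c :: t) :=
        wordCap_insert_head fun v hv => h v (List.mem_cons_of_mem _ hv)
      have hbm : ¬ (a < b ∧ b = m) := fun e => (h b (by simp)).ne e.2
      simp only [insertWord, List.map_cons, List.sum_cons, List.map_map, Function.comp_def,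
        hm, hb, wordCap_cons a, if_neg hbm, zero_add, pow_add, List.sum_map_mul_left] at ih ⊢
      by_cases e : a < b ∧ b = c
      · obtain ⟨e₁, rfl⟩ := e
        have hbb : wordCap (b :: b :: t) = wordCap (b :: t) := by
          rcases t with _ | ⟨d, t⟩
          · simp [wordCap_pair, wordCap_singleton]
          · simp [wordCap_cons b b d t]
        simp only [hbb, e₁, List.length_cons] at ih ⊢
        push_cast at ih ⊢
        simp
        linear_combination x * ih
      · simp only [if_neg e, List.length_cons] at ih ⊢
        push_cast at ih ⊢
        simp
        linear_combination ih

theorem sum_insertCycles {m : ℕ} {c : List (List ℕ)} (h : ∀ w ∈ c, ∀ v ∈ w, v < m) :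
    ((insertCycles m c).map fun c' => if fixSt c' = 0 then x ^ capSt c' else 0).sum =
      if fixSt c = 0 then
        2 * capSt c * x ^ capSt c + (c.flatten.length - 2 * capSt c) * x ^ (capSt c + 1)
      else if fixSt c = 1 then 2 * x ^ (capSt c + 1) else 0 := by
  induction c with
  | nil => simp [insertCycles, fixSt_nil, capSt_nil]
  | cons w c ih =>
    simp only [List.mem_cons, forall_eq_or_imp] at h
    have ih := ih h.2
    have hw := sum_insertWord x h.1
    have h₁ : ((insertWord m w).map fun w' =>
        if fixSt (w' :: c) = 0 then x ^ capSt (w' :: c) else 0).sum =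
        (if fixSt c = 0 then x ^ capSt c else 0) *
          ((insertWord m w).map fun w' => x ^ wordCap w').sum := by
      rw [← List.sum_map_mul_left]
      congr 1
      refine List.map_congr_left fun w' hw' => ?_
      rw [fixSt_cons, if_neg (not_fix_of_mem_insertWord hw'), capSt_cons, zero_add, pow_add]
      split_ifs <;> ring
    have h₂ : ((insertCycles m c).map fun c' =>
        if fixSt (w :: c') = 0 then x ^ capSt (w :: c') else 0).sum =
        (if ∃ k, w = [k, k] then 0 else x ^ wordCap w) *
          ((insertCycles m c).map fun c' => if fixSt c' = 0 then x ^ capSt c' else 0).sum := by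
      rw [← List.sum_map_mul_left]
      congr 1
      refine List.map_congr_left fun c' _ => ?_
      rw [fixSt_cons, capSt_cons, pow_add]
      split_ifs <;> simp_all
    rw [insertCycles, List.map_append, List.sum_append, List.map_map, List.map_map]
    simp only [Function.comp_def]
    rw [h₁, h₂, hw, ih]
    simp only [fixSt_cons, capSt_cons, List.flatten_cons, List.length_append]
    by_cases hf : ∃ k, w = [k, k]
    · obtain ⟨k, rfl⟩ := hf
      have h0 : ∃ k', [k, k] = [k', k'] := ⟨k, rfl⟩
      rw [if_pos h0, if_pos h0]
      simp [wordCap_pair]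
      split_ifs <;> ring
    · simp only [if_neg hf, zero_add]
      push_cast
      split_ifs <;> ring

end GeneratingFunctions

theorem isCycleWord_insert {m : ℕ} {u v : List ℕ} (hu : u ≠ []) (hm : ∀ a ∈ u ++ v, a < m)
    (h : IsCycleWord (u ++ v)) : IsCycleWord (u ++ m :: m :: v) := by
  obtain ⟨-, hc, hh, hs⟩ := h
  have hmu : m ∉ u := fun e => (hm m (by simp [e])).false
  have hmv : m ∉ v := fun e => (hm m (by simp [e])).false
  have hcm : (u ++ m :: m :: v).count m = 2 := by
    simp [List.count_eq_zero_of_not_mem hmu, List.count_eq_zero_of_not_mem hmv]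
  refine ⟨by simp, fun a ha => ?_, fun a ha => ?_, ?_⟩
  · rcases eq_or_ne a m with rfl | ham
    · exact hcm
    · have := hc a (by simp at ha ⊢; tauto)
      simpa [List.count_cons, ham.symm] using this
  · obtain ⟨b, u, rfl⟩ := List.exists_cons_of_ne_nil hu
    rcases eq_or_ne a m with rfl | ham
    · exact (hm b (by simp)).le
    · exact hh a (by simp at ha ⊢; tauto)
  · rw [isStirlingWord_iff] at hs ⊢
    intro a b hab
    rcases eq_or_ne a m with rfl | ham
    · rcases eq_or_ne b a with rfl | hba
      · have := hab.count_le b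
        rw [hcm] at this
        simp at this
      · have h₁ : List.Sublist [a, b, a] (a :: a :: v) := by
          clear hcm hs hh hc hm hu
          induction u with
          | nil => exact hab
          | cons d u ih =>
            simp only [List.mem_cons, not_or] at hmu
            rcases List.sublist_cons_iff.1 hab with h | ⟨r, hr, -⟩
            · exact ih hmu.2 h
            · simp at hr; exact absurd hr.1 hmu.1
        have h₂ := List.cons_sublist_cons.1 h₁
        rcases List.sublist_cons_iff.1 h₂ with h | ⟨r, hr, -⟩
        · exact absurd (h.subset (by simp)) hmv
        · simp at hr; exact absurd hr.1 hba
    · rcases eq_or_ne b m with rfl | hbm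
      · exact hm a (by have := hab.subset (List.mem_cons_self); simp at this ⊢; tauto)
      · have := hab.filter (fun z => z != m)
        have hf : (u ++ v).filter (fun z => z != m) = u ++ v :=
          List.filter_eq_self.2 fun z hz => by simpa using (hm z hz).ne
        rw [List.filter_append] at hf
        simp [ham, hbm, hf] at this
        exact hs a b this

theorem IsCycleWord.exists_eq_insert {m : ℕ} {w : List ℕ} (h : IsCycleWord w) (hmw : m ∈ w)
    (hm : ∀ a ∈ w, a ≤ m) (hne : w ≠ [m, m]) :
    ∃ u v, u ≠ [] ∧ w = u ++ m :: m :: v ∧ m ∉ u ∧ m ∉ v := by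
  obtain ⟨-, hc, hh, hs⟩ := h
  obtain ⟨u, t, rfl, hu⟩ := List.eq_append_cons_of_mem hmw
  have hcm := hc m hmw
  simp [List.count_eq_zero_of_not_mem hu] at hcm
  obtain ⟨s, v, rfl, hs'⟩ := List.eq_append_cons_of_mem
    (List.count_pos_iff.1 (hcm.symm ▸ Nat.one_pos) : m ∈ t)
  simp [List.count_eq_zero_of_not_mem hs'] at hcm
  rw [isStirlingWord_iff] at hs
  rcases s with _ | ⟨b, s⟩
  · refine ⟨u, v, ?_, rfl, hu, List.count_eq_zero.1 hcm⟩
    rintro rfl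
    refine hne ?_
    rcases v with _ | ⟨a, v⟩
    · rfl
    · have h₁ := hh a (by simp)
      have h₂ := hm a (by simp)
      simp only [List.nil_append, List.headI_cons] at h₁
      simp only [List.count_cons, beq_iff_eq, le_antisymm h₂ h₁] at hcm
      simp at hcm
  · have := hs m b (by
      refine List.Sublist.trans ?_ (List.sublist_append_right _ _)
      simp)
    have := hm b (by simp)
    omega

theorem IsCycleWord.remove {m : ℕ} {u v : List ℕ} (hu : u ≠ []) (hmu : m ∉ u) (hmv : m ∉ v)
    (h : IsCycleWord (u ++ m :: m :: v)) : IsCycleWord (u ++ v) := by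
  obtain ⟨-, hc, hh, hs⟩ := h
  refine ⟨by simp [hu], fun a ha => ?_, fun a ha => ?_, ?_⟩
  · have ham : m ≠ a := by rintro rfl; simp [hmu, hmv] at ha
    have := hc a (by simp at ha ⊢; tauto)
    simpa [List.count_cons, ham] using this
  · have := hh a (by simp at ha ⊢; tauto)
    obtain ⟨b, u, rfl⟩ := List.exists_cons_of_ne_nil hu
    exact this
  · rw [isStirlingWord_iff] at hs ⊢
    intro a b hab
    refine hs a b (hab.trans ?_)
    simp

/-- `c` is the standard cycle form of a Stirling permutation of the second kind on the value
set `S`. -/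
def IsCyclesOn (S : Finset ℕ) (c : List (List ℕ)) : Prop :=
  (∀ v, c.flatten.count v = if v ∈ S then 2 else 0) ∧ (∀ w ∈ c, IsCycleWord w) ∧
    (c.map List.headI).Pairwise (· < ·)

theorem count_baseList (n v : ℕ) :
    (baseList n).count v = if v ∈ Finset.Icc 1 n then 2 else 0 := by
  induction n with
  | zero => simp [baseList]
  | succ n ih =>
    have : baseList (n + 1) = baseList n ++ [n + 1, n + 1] := by
      simp [baseList, List.range_succ]
    rw [this, List.count_append, ih]
    simp only [List.count_cons, List.count_nil, Finset.mem_Icc, beq_iff_eq]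
    split_ifs <;> omega

theorem length_baseList (n : ℕ) : (baseList n).length = 2 * n := by
  simp [baseList, mul_comm]

theorem isStirling2_iff {n : ℕ} {c : List (List ℕ)} :
    IsStirling2 n c ↔ IsCyclesOn (Finset.Icc 1 n) c := by
  rw [IsStirling2, IsCyclesOn, List.perm_iff_count, List.pairwise_map,
    ← List.isChain_iff_pairwise (R := fun a b : List ℕ => a.headI < b.headI)]
  simp only [count_baseList]
  rfl

theorem exists_splitWrtComposition_eq {N : ℕ} {c : List (List ℕ)} (h : c.flatten.length = N)
    (hc : ∀ w ∈ c, w ≠ []) : ∃ p : Composition N, c.flatten.splitWrtComposition p = c := by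
  subst h
  refine ⟨⟨c.map List.length, ?_, by simp⟩, List.splitWrtComposition_flatten _ _ rfl⟩
  intro i hi
  obtain ⟨w, hw, rfl⟩ := List.mem_map.1 hi
  exact List.length_pos_iff.2 (hc w hw)

theorem mem_stirling2 {n : ℕ} {c : List (List ℕ)} :
    c ∈ stirling2 n ↔ IsCyclesOn (Finset.Icc 1 n) c := by
  rw [stirling2, Finset.mem_filter, isStirling2_iff, and_iff_right_iff_imp, ← isStirling2_iff]
  intro h
  obtain ⟨p, hp⟩ := exists_splitWrtComposition_eq
    (h.1.length_eq.trans (length_baseList n)) fun w hw => (h.2.1 w hw).1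
  exact Finset.mem_image.2 ⟨(c.flatten, p), by simpa using h.1, hp⟩

theorem finite_isCyclesOn (S : Finset ℕ) : {c | IsCyclesOn S c}.Finite := by
  set L := S.toList ++ S.toList with hL
  refine ((L.permutations.toFinset ×ˢ (Finset.univ : Finset (Composition L.length))).image
      (fun p => p.1.splitWrtComposition p.2)).finite_toSet.subset ?_
  intro c hc
  have hp : c.flatten.Perm L := by
    rw [List.perm_iff_count]
    intro v
    rw [hc.1, hL, List.count_append, List.Nodup.count S.nodup_toList]
    simp only [Finset.mem_toList]
    split_ifs <;> rfl
  obtain ⟨p, hp'⟩ := exists_splitWrtComposition_eq hp.length_eq fun w hw => (hc.2.1 w hw).1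
  exact Finset.mem_coe.2 (Finset.mem_image.2 ⟨(c.flatten, p), by simpa using hp, hp'⟩)

/-- The Stirling permutations of the second kind on the value set `S`. -/
def cyclesOn (S : Finset ℕ) : Finset (List (List ℕ)) := (finite_isCyclesOn S).toFinset

theorem mem_cyclesOn {S : Finset ℕ} {c : List (List ℕ)} : c ∈ cyclesOn S ↔ IsCyclesOn S c := by
  simp [cyclesOn]

theorem stirling2_eq_cyclesOn (n : ℕ) : stirling2 n = cyclesOn (Finset.Icc 1 n) := by
  ext c
  rw [mem_stirling2, mem_cyclesOn]

namespace IsCyclesOn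

variable {S : Finset ℕ} {c : List (List ℕ)}

theorem mem_iff (h : IsCyclesOn S c) {v : ℕ} : v ∈ c.flatten ↔ v ∈ S := by
  rw [← List.count_pos_iff, h.1]
  split_ifs with hv <;> simp [hv]

theorem mem_of_mem (h : IsCyclesOn S c) {w : List ℕ} (hw : w ∈ c) {v : ℕ} (hv : v ∈ w) : v ∈ S :=
  h.mem_iff.1 (List.mem_flatten.2 ⟨w, hw, hv⟩)

theorem length_flatten (h : IsCyclesOn S c) : c.flatten.length = 2 * S.card := by
  have hp : c.flatten.Perm (S.toList ++ S.toList) := by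
    rw [List.perm_iff_count]
    intro v
    rw [h.1, List.count_append, List.Nodup.count S.nodup_toList]
    simp only [Finset.mem_toList]
    split_ifs <;> rfl
  rw [hp.length_eq]
  simp [two_mul]

theorem insert {m : ℕ} {c₁ c₂ : List (List ℕ)} {u v : List ℕ}
    (h : IsCyclesOn S (c₁ ++ (u ++ v) :: c₂)) (hm : ∀ a ∈ S, a < m) (hu : u ≠ []) :
    IsCyclesOn (insert m S) (c₁ ++ (u ++ m :: m :: v) :: c₂) := by
  refine ⟨fun a => ?_, fun w hw => ?_, ?_⟩
  · have := h.1 a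
    have hmS : m ∉ S := fun e => (hm m e).false
    simp only [List.flatten_append, List.flatten_cons, List.count_append, List.count_cons,
      beq_iff_eq, Finset.mem_insert] at this ⊢
    rcases eq_or_ne a m with rfl | ham
    · simp [hmS] at this ⊢
      simp [this]
    · simp [ham, ham.symm] at this ⊢
      omega
  · rcases List.mem_append.1 hw with hw | hw
    · exact h.2.1 w (by simp [hw])
    · rcases List.mem_cons.1 hw with rfl | hw
      · exact isCycleWord_insert hu (fun a ha => hm a (h.mem_of_mem (w := u ++ v) (by simp) ha))
          (h.2.1 _ (by simp))
      · exact h.2.1 w (by simp [hw])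
  · obtain ⟨b, u, rfl⟩ := List.exists_cons_of_ne_nil hu
    simpa using h.2.2

theorem exists_of_insert {m : ℕ} (h : IsCyclesOn (Insert.insert m S) c) (hm : ∀ a ∈ S, a < m)
    (hf : fixSt c = 0) : ∃ c₁ u v c₂, u ≠ [] ∧ c = c₁ ++ (u ++ m :: m :: v) :: c₂ ∧
      IsCyclesOn S (c₁ ++ (u ++ v) :: c₂) := by
  obtain ⟨w, hw, hmw⟩ := List.mem_flatten.1 (h.mem_iff.2 (Finset.mem_insert_self m S))
  obtain ⟨c₁, c₂, rfl⟩ := List.append_of_mem hw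
  have hcw := h.2.1 w hw
  have hle : ∀ a ∈ w, a ≤ m := fun a ha => by
    rcases Finset.mem_insert.1 (h.mem_of_mem hw ha) with rfl | h'
    exacts [le_rfl, (hm a h').le]
  obtain ⟨u, v, hu, rfl, hmu, hmv⟩ := hcw.exists_eq_insert hmw hle
    fun e => fixSt_eq_zero_iff.1 hf m (e ▸ hw)
  have hmS : m ∉ S := fun e => (hm m e).false
  refine ⟨c₁, u, v, c₂, hu, rfl, fun a => ?_, fun w hw => ?_, ?_⟩
  · have := h.1 a
    simp only [List.flatten_append, List.flatten_cons, List.count_append, List.count_cons,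
      beq_iff_eq, Finset.mem_insert] at this ⊢
    rcases eq_or_ne a m with rfl | ham
    · simp [hmS] at this ⊢
      omega
    · simp [ham, ham.symm] at this ⊢
      omega
  · rcases List.mem_append.1 hw with hw | hw
    · exact h.2.1 w (by simp [hw])
    · rcases List.mem_cons.1 hw with rfl | hw
      · exact hcw.remove hu hmu hmv
      · exact h.2.1 w (by simp [hw])
  · obtain ⟨b, u, rfl⟩ := List.exists_cons_of_ne_nil hu
    simpa using h.2.2

end IsCyclesOn

/-- Deletion of the letter `m` from all cycles. -/
def deleteLetter (m : ℕ) (c : List (List ℕ)) : List (List ℕ) :=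
  c.map fun w => w.filter fun z => z != m

theorem deleteLetter_eq_self {m : ℕ} {c : List (List ℕ)} (h : ∀ w ∈ c, m ∉ w) :
    deleteLetter m c = c := by
  refine (List.map_congr_left fun w hw => ?_).trans (List.map_id c)
  refine List.filter_eq_self.2 fun z hz => ?_
  simpa using fun e : z = m => h w hw (e ▸ hz)

theorem deleteLetter_insert {m : ℕ} {c₁ c₂ : List (List ℕ)} {u v : List ℕ}
    (h : ∀ w ∈ c₁ ++ (u ++ v) :: c₂, m ∉ w) :
    deleteLetter m (c₁ ++ (u ++ m :: m :: v) :: c₂) = c₁ ++ (u ++ v) :: c₂ := by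
  rw [← deleteLetter_eq_self h]
  simp [deleteLetter]

theorem filter_deleteLetter_eq {S : Finset ℕ} {m : ℕ} (hm : ∀ a ∈ S, a < m) {c : List (List ℕ)}
    (hc : IsCyclesOn S c) :
    ((cyclesOn (insert m S)).filter (fun c' => fixSt c' = 0)).filter
      (fun c' => deleteLetter m c' = c) =
      (insertCycles m c).toFinset.filter (fun c' => fixSt c' = 0) := by
  have hmem {d} (hd : IsCyclesOn S d) : ∀ w ∈ d, m ∉ w := fun w hw e =>
    (hm m (hd.mem_of_mem hw e)).false
  ext c'
  simp only [Finset.mem_filter, mem_cyclesOn, List.mem_toFinset, mem_insertCycles]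
  constructor
  · rintro ⟨⟨h, hf⟩, rfl⟩
    obtain ⟨c₁, u, v, c₂, hu, rfl, h'⟩ := h.exists_of_insert hm hf
    exact ⟨⟨c₁, u, v, c₂, hu, deleteLetter_insert (hmem h'), rfl⟩, hf⟩
  · rintro ⟨⟨c₁, u, v, c₂, hu, rfl, rfl⟩, hf⟩
    exact ⟨⟨hc.insert hm hu, hf⟩, deleteLetter_insert (hmem hc)⟩

open MvPolynomial

/-- The generating polynomial of the Stirling derangements on the value set `S`. -/
def derangementPoly (S : Finset ℕ) : MvPolynomial (Fin 2) ℚ :=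
  ∑ c ∈ (cyclesOn S).filter (fun c => fixSt c = 0), X 0 ^ capSt c * X 1 ^ cyc c

theorem Rq_eq_derangementPoly (n : ℕ) : Rq n = derangementPoly (Finset.Icc 1 n) := by
  rw [Rq, Rnk, derangementPoly, stirling2_eq_cyclesOn]

theorem X_mul_pderiv_monomial (a b : ℕ) :
    (X 0 * pderiv 0 (X 0 ^ a * X 1 ^ b) : MvPolynomial (Fin 2) ℚ) =
      (a : MvPolynomial (Fin 2) ℚ) * (X 0 ^ a * X 1 ^ b) := by
  have h : pderiv (0 : Fin 2) (X 1 : MvPolynomial (Fin 2) ℚ) = 0 :=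
    pderiv_X_of_ne (by decide)
  rw [pderiv_mul, pderiv_pow, pderiv_pow, h, pderiv_X_self]
  rcases a with _ | a
  · rw [Nat.cast_zero]
    simp
  · simp
    ring

theorem derangementPoly_insert_eq_sum {S : Finset ℕ} {m : ℕ} (hm : ∀ a ∈ S, a < m) :
    derangementPoly (insert m S) =
      ((2 * S.card : ℕ) : MvPolynomial (Fin 2) ℚ) * X 0 * derangementPoly S +
        2 * X 0 * (1 - X 0) * pderiv 0 (derangementPoly S) +
        2 * X 0 * ∑ c ∈ (cyclesOn S).filter (fun c => fixSt c = 1), X 0 ^ capSt c * X 1 ^ cyc c := by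
  have hfib : ∀ c ∈ cyclesOn S,
      (∑ c' ∈ ((cyclesOn (insert m S)).filter (fun c' => fixSt c' = 0)).filter
        (fun c' => deleteLetter m c' = c), X 0 ^ capSt c' * X 1 ^ cyc c' :
          MvPolynomial (Fin 2) ℚ) =
      (if fixSt c = 0 then (2 * (capSt c : MvPolynomial (Fin 2) ℚ) * X 0 ^ capSt c +
          (((2 * S.card : ℕ) : MvPolynomial (Fin 2) ℚ) - 2 * (capSt c : MvPolynomial (Fin 2) ℚ)) *
            X 0 ^ (capSt c + 1)) * X 1 ^ cyc c else 0) +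
        (if fixSt c = 1 then 2 * X 0 ^ (capSt c + 1) * X 1 ^ cyc c else 0) := by
    intro c hc
    rw [mem_cyclesOn] at hc
    have hlt : ∀ w ∈ c, ∀ v ∈ w, v < m := fun w hw v hv => hm v (hc.mem_of_mem hw hv)
    have hsum := sum_insertCycles (X 0 : MvPolynomial (Fin 2) ℚ) hlt
    rw [hc.length_flatten] at hsum
    rw [filter_deleteLetter_eq hm hc, Finset.sum_filter,
      List.sum_toFinset _ (nodup_insertCycles fun w hw e => (hlt w hw m e).false)]
    have : (insertCycles m c).map (fun c' => if fixSt c' = 0 then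
        (X 0 ^ capSt c' * X 1 ^ cyc c' : MvPolynomial (Fin 2) ℚ) else 0) =
        (insertCycles m c).map (fun c' => (if fixSt c' = 0 then X 0 ^ capSt c' else 0) *
          X 1 ^ cyc c) := by
      refine List.map_congr_left fun c' hc' => ?_
      rw [cyc, cyc, length_of_mem_insertCycles hc', ite_mul, zero_mul]
    rw [this, List.sum_map_mul_right, hsum]
    by_cases h0 : fixSt c = 0
    · simp [h0]
    · simp [h0]
  have hmaps : ∀ c' ∈ (cyclesOn (insert m S)).filter (fun c' => fixSt c' = 0),
      deleteLetter m c' ∈ cyclesOn S := by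
    intro c' hc'
    rw [Finset.mem_filter, mem_cyclesOn] at hc'
    obtain ⟨c₁, u, v, c₂, hu, rfl, h⟩ := hc'.1.exists_of_insert hm hc'.2
    rw [deleteLetter_insert fun w hw e => (hm m (h.mem_of_mem hw e)).false]
    exact mem_cyclesOn.2 h
  rw [derangementPoly, ← Finset.sum_fiberwise_of_maps_to hmaps, Finset.sum_congr rfl hfib,
    Finset.sum_add_distrib, ← Finset.sum_filter, ← Finset.sum_filter, derangementPoly,
    map_sum, Finset.mul_sum, Finset.mul_sum, Finset.mul_sum, ← Finset.sum_add_distrib]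
  congr 1
  · refine Finset.sum_congr rfl fun c _ => ?_
    have := X_mul_pderiv_monomial (capSt c) (cyc c)
    linear_combination (-2 * (1 - X 0)) * this
  · refine Finset.sum_congr rfl fun c _ => ?_
    ring

namespace IsCyclesOn

variable {S : Finset ℕ} {c d : List (List ℕ)} {k : ℕ}

theorem erase_fix (h : IsCyclesOn S c) (hk : [k, k] ∈ c) :
    IsCyclesOn (S.erase k) (c.erase [k, k]) := by
  refine ⟨fun a => ?_, fun w hw => h.2.1 w (List.mem_of_mem_erase hw),
    h.2.2.sublist (List.erase_sublist.map _)⟩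
  have h₁ := h.1 a
  rw [(List.perm_cons_erase hk).flatten.count_eq] at h₁
  have hkS : k ∈ S := h.mem_of_mem hk (by simp)
  simp only [List.flatten_cons, List.count_append, List.count_cons, List.count_nil, beq_iff_eq,
    Finset.mem_erase] at h₁ ⊢
  rcases eq_or_ne a k with rfl | hak
  · simp [hkS] at h₁ ⊢
    exact h₁
  · simp [hak, hak.symm] at h₁ ⊢
    omega

theorem isCycleWord_pair (k : ℕ) : IsCycleWord [k, k] := by
  refine ⟨by simp, by simp, by simp, isStirlingWord_iff.2 fun a b h => ?_⟩
  have := h.length_le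
  simp at this

theorem exists_insert_fix (h : IsCyclesOn (S.erase k) d) (hk : k ∈ S) :
    ∃ c, c.Perm ([k, k] :: d) ∧ IsCyclesOn S c := by
  let r : List ℕ → List ℕ → Prop := fun a b => a.headI ≤ b.headI
  have : Std.Total r := ⟨fun a b => le_total _ _⟩
  have : IsTrans (List ℕ) r := ⟨fun a b c => le_trans⟩
  have hp := List.perm_orderedInsert r [k, k] d
  have hd : d.Pairwise r := (List.pairwise_map.1 h.2.2).imp le_of_lt
  have hnd : (([k, k] :: d).map List.headI).Nodup := by
    refine List.nodup_cons.2 ⟨fun hk' => ?_, h.2.2.imp ne_of_lt⟩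
    obtain ⟨w, hw, hwk⟩ := List.mem_map.1 hk'
    obtain ⟨a, w, rfl⟩ := List.exists_cons_of_ne_nil (h.2.1 w hw).1
    have := h.mem_of_mem hw (List.mem_cons_self)
    exact (Finset.mem_erase.1 this).1 hwk
  refine ⟨_, hp, fun a => ?_, fun w hw => ?_, ?_⟩
  · have h₁ := h.1 a
    rw [hp.flatten.count_eq]
    simp only [List.flatten_cons, List.count_append, List.count_cons, List.count_nil, beq_iff_eq,
      Finset.mem_erase] at h₁ ⊢
    rcases eq_or_ne a k with rfl | hak
    · simp [hk] at h₁ ⊢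
      exact h₁
    · simp [hak, hak.symm] at h₁ ⊢
      omega
  · rcases List.mem_cons.1 (hp.subset hw) with rfl | hw
    · exact isCycleWord_pair k
    · exact h.2.1 w hw
  · have h₁ : ((List.orderedInsert r [k, k] d).map List.headI).Pairwise (· ≤ ·) :=
      List.pairwise_map.2 (hd.orderedInsert _ _)
    exact (h₁.and ((hp.map _).nodup_iff.2 hnd)).imp fun h => lt_of_le_of_ne h.1 h.2

theorem eq_of_perm (hc : IsCyclesOn S c) (hd : IsCyclesOn S d) (h : c.Perm d) : c = d :=
  h.eq_of_pairwise (fun _ _ _ _ h₁ h₂ => absurd h₁ (lt_asymm h₂))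
    (List.pairwise_map.1 hc.2.2) (List.pairwise_map.1 hd.2.2)

end IsCyclesOn

theorem fixSt_erase {c : List (List ℕ)} {k : ℕ} (hk : [k, k] ∈ c) :
    fixSt c = 1 + fixSt (c.erase [k, k]) := by
  rw [fixSt_perm (List.perm_cons_erase hk), fixSt_cons, if_pos ⟨k, rfl⟩]

theorem existsUnique_of_fixSt_eq_one {c : List (List ℕ)} (h : fixSt c = 1) :
    ∃! k, [k, k] ∈ c := by
  obtain ⟨k, hk⟩ : ∃ k, [k, k] ∈ c := by
    by_contra! h'
    rw [fixSt_eq_zero_iff.2 h'] at h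
    exact zero_ne_one h
  refine ⟨k, hk, fun j hj => ?_⟩
  have h0 : fixSt (c.erase [k, k]) = 0 := by
    have := fixSt_erase hk
    omega
  by_contra hjk
  exact fixSt_eq_zero_iff.1 h0 j ((List.mem_erase_of_ne (by simpa using hjk)).2 hj)

theorem sum_one_fix_eq_derangementPoly_erase {S : Finset ℕ} {k : ℕ} (hk : k ∈ S) :
    (∑ c ∈ (cyclesOn S).filter (fun c => fixSt c = 1 ∧ [k, k] ∈ c),
      X 0 ^ capSt c * X 1 ^ cyc c : MvPolynomial (Fin 2) ℚ) =
      X 1 * derangementPoly (S.erase k) := by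
  rw [derangementPoly, Finset.mul_sum]
  refine Finset.sum_bij (fun c _ => c.erase [k, k]) ?_ ?_ ?_ ?_
  · intro c hc
    simp only [Finset.mem_filter, mem_cyclesOn] at hc ⊢
    obtain ⟨hc, hf, hkc⟩ := hc
    have := fixSt_erase hkc
    exact ⟨hc.erase_fix hkc, by omega⟩
  · intro c hc d hd hcd
    simp only [Finset.mem_filter, mem_cyclesOn] at hc hd hcd
    refine hc.1.eq_of_perm hd.1 ((List.perm_cons_erase hc.2.2).trans ?_)
    rw [hcd]
    exact (List.perm_cons_erase hd.2.2).symm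
  · intro d hd
    simp only [Finset.mem_filter, mem_cyclesOn] at hd
    obtain ⟨c, hp, hc⟩ := hd.1.exists_insert_fix hk
    have hkc : [k, k] ∈ c := hp.symm.subset List.mem_cons_self
    refine ⟨c, ?_, ?_⟩
    · simp only [Finset.mem_filter, mem_cyclesOn]
      refine ⟨hc, ?_, hkc⟩
      rw [fixSt_perm hp, fixSt_cons, if_pos ⟨k, rfl⟩, hd.2]
    · refine (hc.erase_fix hkc).eq_of_perm hd.1 ?_
      simpa using hp.erase [k, k]
  · intro c hc
    have hkc := (Finset.mem_filter.1 hc).2.2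
    have hp := List.perm_cons_erase hkc
    rw [capSt_perm hp, cyc, hp.length_eq, capSt_cons, wordCap_pair, zero_add, List.length_cons,
      pow_succ, cyc]
    ring

theorem sum_one_fix {S : Finset ℕ} :
    (∑ c ∈ (cyclesOn S).filter (fun c => fixSt c = 1), X 0 ^ capSt c * X 1 ^ cyc c :
      MvPolynomial (Fin 2) ℚ) = X 1 * ∑ k ∈ S, derangementPoly (S.erase k) := by
  rw [Finset.mul_sum, ← Finset.sum_congr rfl fun k hk => sum_one_fix_eq_derangementPoly_erase hk,
    Finset.sum_comm' (t' := (cyclesOn S).filter (fun c => fixSt c = 1))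
      (s' := fun c => S.filter fun k => [k, k] ∈ c)]
  · refine Finset.sum_congr rfl fun c hc => ?_
    rw [Finset.mem_filter, mem_cyclesOn] at hc
    obtain ⟨k, hk, huniq⟩ := existsUnique_of_fixSt_eq_one hc.2
    have : S.filter (fun k => [k, k] ∈ c) = {k} := by
      ext j
      simp only [Finset.mem_filter, Finset.mem_singleton]
      refine ⟨fun h => huniq j h.2, ?_⟩
      rintro rfl
      exact ⟨hc.1.mem_of_mem hk (by simp), hk⟩
    rw [this, Finset.sum_singleton]
  · intro k c
    simp only [Finset.mem_filter]
    tauto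

theorem derangementPoly_insert {S : Finset ℕ} {m : ℕ} (hm : ∀ a ∈ S, a < m) :
    derangementPoly (insert m S) =
      ((2 * S.card : ℕ) : MvPolynomial (Fin 2) ℚ) * X 0 * derangementPoly S +
        2 * X 0 * (1 - X 0) * pderiv 0 (derangementPoly S) +
        2 * X 0 * X 1 * ∑ k ∈ S, derangementPoly (S.erase k) := by
  rw [derangementPoly_insert_eq_sum hm, sum_one_fix]
  ring

theorem Icc_one_succ (n : ℕ) : Finset.Icc 1 (n + 1) = insert (n + 1) (Finset.Icc 1 n) :=
  (Finset.insert_Icc_right_eq_Icc_add_one (by omega)).symm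

theorem lt_succ_of_mem_Icc (n : ℕ) : ∀ a ∈ Finset.Icc 1 n, a < n + 1 := fun _ ha =>
  Nat.lt_succ_of_le (Finset.mem_Icc.1 ha).2

theorem derangementPoly_eq_Rq (S : Finset ℕ) : derangementPoly S = Rq S.card := by
  induction h : S.card using Nat.strong_induction_on generalizing S with
  | _ n ih =>
    rcases n with _ | n
    · rw [Finset.card_eq_zero.1 h, Rq_eq_derangementPoly]
      rfl
    · have herase : ∀ T : Finset ℕ, T.card = n →
          ∑ k ∈ T, derangementPoly (T.erase k) = ∑ k ∈ T, Rq (n - 1) := fun T hT =>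
        Finset.sum_congr rfl fun k hk =>
          ih (n - 1) (by omega) _ (by rw [Finset.card_erase_of_mem hk, hT])
      have hne : S.Nonempty := Finset.card_pos.1 (by omega)
      have hm := S.max'_mem hne
      have hcard : (S.erase (S.max' hne)).card = n := by
        rw [Finset.card_erase_of_mem hm, h, Nat.add_sub_cancel]
      have hIcc : (Finset.Icc 1 n).card = n := by simp
      rw [← Finset.insert_erase hm,
        derangementPoly_insert fun a ha => Finset.lt_max'_of_mem_erase_max' S hne ha,
        Rq_eq_derangementPoly, Icc_one_succ, derangementPoly_insert (lt_succ_of_mem_Icc n),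
        herase _ hcard, herase _ hIcc, hcard, hIcc, ih n (by omega) _ hcard,
        ih n (by omega) _ hIcc, Finset.sum_const, Finset.sum_const, hcard, hIcc]

theorem Rq_succ (n : ℕ) :
    Rq (n + 1) =
      ((2 * n : ℕ) : MvPolynomial (Fin 2) ℚ) * X 0 * Rq n +
        2 * X 0 * (1 - X 0) * pderiv 0 (Rq n) +
        ((2 * n : ℕ) : MvPolynomial (Fin 2) ℚ) * X 0 * X 1 * Rq (n - 1) := by
  have hsum : ∑ k ∈ Finset.Icc 1 n, derangementPoly ((Finset.Icc 1 n).erase k) =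
      n * Rq (n - 1) := by
    rw [Finset.sum_congr rfl fun k hk => by
      rw [derangementPoly_eq_Rq, Finset.card_erase_of_mem hk, Nat.card_Icc, Nat.add_sub_cancel]]
    simp
  rw [Rq_eq_derangementPoly (n + 1), Icc_one_succ, derangementPoly_insert (lt_succ_of_mem_Icc n),
    hsum, ← Rq_eq_derangementPoly, Nat.card_Icc, Nat.add_sub_cancel]
  push_cast
  ring

theorem Rq_zero : Rq 0 = 1 := by
  have h : (cyclesOn ∅).filter (fun c => fixSt c = 0) = {[]} := by
    ext c
    simp only [Finset.mem_filter, mem_cyclesOn, Finset.mem_singleton]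
    constructor
    · rintro ⟨h, -⟩
      refine List.eq_nil_iff_forall_not_mem.2 fun w hw => ?_
      obtain ⟨a, w, rfl⟩ := List.exists_cons_of_ne_nil (h.2.1 w hw).1
      simpa using h.mem_of_mem hw List.mem_cons_self
    · rintro rfl
      exact ⟨⟨by simp, by simp, by simp⟩, fixSt_nil⟩
  rw [Rq_eq_derangementPoly, Finset.Icc_eq_empty (by simp), derangementPoly, h]
  simp [capSt_nil, cyc]

open MvPolynomial in
/-- `R_0 = 1`, `R_1 = 0`, and for every `n ≥ 1`:
`R_{n+1}(x,q) = 2nx R_n(x,q) + 2x(1-x) ∂R_n/∂x + 2nxq R_{n-1}(x,q)`. -/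
theorem stmt16 :
    Rq 0 = 1 ∧ Rq 1 = 0 ∧
    ∀ n : ℕ, 1 ≤ n →
      Rq (n + 1) =
        ((2 * n : ℕ) : MvPolynomial (Fin 2) ℚ) * X 0 * Rq n +
          2 * X 0 * (1 - X 0) * pderiv 0 (Rq n) +
          ((2 * n : ℕ) : MvPolynomial (Fin 2) ℚ) * X 0 * X 1 * Rq (n - 1) := by
  refine ⟨Rq_zero, ?_, fun n _ => Rq_succ n⟩
  rw [Rq_succ 0, Rq_zero]
  simp
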